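/- Let φ denote Euler's totient function and let B := {n·φ(n) : n ∈ ℕ}. Then for every integer k ≥ 2, the set D^k(B) is dense in S^{k-1}. -/

import Mathlib

open Set Filter Topology

noncomputable def rho {k : ℕ} (u : Fin k → ℝ) : EuclideanSpace ℝ (Fin k) :=
  ‖((EuclideanSpace.equiv (Fin k) ℝ).symm u : EuclideanSpace ℝ (Fin k))‖⁻¹ •
    ((EuclideanSpace.equiv (Fin k) ℝ).symm u)

def unitSphere (k : ℕ) : Set (EuclideanSpace ℝ (Fin k)) :=
  {x | ‖x‖ = 1 ∧ ∀ i, x i ∈ Icc (0:ℝ) 1}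

def genDir (k : ℕ) (U : Fin k → Set ℕ) : Set (EuclideanSpace ℝ (Fin k)) :=
  {y | ∃ u : Fin k → ℕ, (∀ i, u i ∈ U i) ∧ y = rho (fun i => (u i : ℝ))}

def genDirDistinct (k : ℕ) (U : Fin k → Set ℕ) : Set (EuclideanSpace ℝ (Fin k)) :=
  {y | ∃ u : Fin k → ℕ, (∀ i, u i ∈ U i) ∧ (∀ i j, i ≠ j → u i ≠ u j) ∧
    y = rho (fun i => (u i : ℝ))}

def dirSet (k : ℕ) (A : Set ℕ) : Set (EuclideanSpace ℝ (Fin k)) :=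
  {y | ∃ u : Fin k → ℕ, (∀ i, u i ∈ A) ∧ y = rho (fun i => (u i : ℝ))}

def accSet {α : Type*} [TopologicalSpace α] (Y : Set α) : Set α := {x | AccPt x (𝓟 Y)}


lemma rho_smul {k : ℕ} (c : ℝ) (hc : 0 < c) (u : Fin k → ℝ) : rho (c • u) = rho u := by
  unfold rho
  rw [map_smul, norm_smul, smul_smul, Real.norm_of_nonneg hc.le, mul_inv_rev, mul_assoc,
    inv_mul_cancel₀ hc.ne', mul_one]

lemma totient_mul_dvd (a L : ℕ) (ha : 0 < a) (h : a ∣ L) :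
    Nat.totient (a * L) = a * Nat.totient L := by
  have h1 := Nat.totient_gcd_mul_totient_mul a L
  rw [Nat.gcd_eq_left h] at h1
  have h2 : 0 < Nat.totient a := Nat.totient_pos.2 ha
  apply Nat.eq_of_mul_eq_mul_left h2
  rw [h1]; ring

lemma sq_mem {k : ℕ} (a : Fin k → ℕ) (ha : ∀ i, 0 < a i) :
    rho (fun i => ((a i : ℝ)) ^ 2) ∈
      dirSet k {m : ℕ | ∃ n : ℕ, 0 < n ∧ m = n * Nat.totient n} := by
  set L := ∏ i, a i with hL
  have hLpos : 0 < L := Finset.prod_pos fun i _ => ha i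
  refine ⟨fun i => (a i * L) * Nat.totient (a i * L),
    fun i => ⟨a i * L, Nat.mul_pos (ha i) hLpos, rfl⟩, ?_⟩
  have hc : (0:ℝ) < (L : ℝ) * (Nat.totient L : ℝ) := by
    have := Nat.totient_pos.2 hLpos
    positivity
  rw [← rho_smul _ hc]
  congr 1
  funext i
  have hd : a i ∣ L := Finset.dvd_prod_of_mem a (Finset.mem_univ i)
  simp only [Pi.smul_apply, smul_eq_mul]
  rw [totient_mul_dvd _ L (ha i) hd]
  push_cast
  ring

/-- For B = {n·φ(n) : n ∈ ℕ}, where φ is Euler's totient function, the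
k-direction set D^k(B) is dense in S^{k-1} for every k ≥ 2. -/
theorem stmt_12 (k : ℕ) (hk : 2 ≤ k) :
    unitSphere k ⊆
      closure (dirSet k {m : ℕ | ∃ n : ℕ, 0 < n ∧ m = n * Nat.totient n}) := by
  rintro x ⟨hx, hx0⟩
  have hlim : Tendsto (fun N : ℕ => fun i : Fin k =>
      (((⌊Real.sqrt (x i) * (N:ℝ)⌋₊ + 1 : ℕ) : ℝ) / (N:ℝ)) ^ 2) atTop (𝓝 (fun i => x i)) := by
    rw [tendsto_pi_nhds]
    intro i
    have h1 := (tendsto_nat_floor_mul_div_atTop (Real.sqrt_nonneg (x i))).comp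
      (tendsto_natCast_atTop_atTop (R := ℝ))
    have h2 := ((h1.add (tendsto_one_div_atTop_nhds_zero_nat (𝕜 := ℝ))).pow 2)
    rw [add_zero, Real.sq_sqrt (hx0 i).1] at h2
    refine h2.congr fun N => ?_
    simp only [Function.comp]
    push_cast
    rw [add_div]
  have hex : (EuclideanSpace.equiv (Fin k) ℝ).symm (fun i => x i) = x := by
    ext i; rfl
  have hcont : ContinuousAt (rho (k := k)) (fun i => x i) := by
    unfold rho
    have hc : Continuous (fun u : Fin k → ℝ => (EuclideanSpace.equiv (Fin k) ℝ).symm u) :=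
      (EuclideanSpace.equiv (Fin k) ℝ).symm.continuous
    refine ContinuousAt.smul (ContinuousAt.inv₀ hc.norm.continuousAt ?_) hc.continuousAt
    rw [hex, hx]; exact one_ne_zero
  have hrx : rho (fun i => x i) = x := by
    unfold rho
    rw [hex, hx]; simp
  have ht := hcont.tendsto.comp hlim
  rw [hrx] at ht
  refine mem_closure_of_tendsto ht ?_
  filter_upwards [eventually_gt_atTop 0] with N hN
  have hN' : (0:ℝ) < ((N:ℝ) ^ 2)⁻¹ := by positivity
  have := sq_mem (fun i : Fin k => ⌊Real.sqrt (x i) * (N:ℝ)⌋₊ + 1) (fun i => Nat.succ_pos _)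
  rw [← rho_smul _ hN'] at this
  convert this using 1
  simp only [Function.comp]
  congr 1
  funext i
  simp only [Pi.smul_apply, smul_eq_mul, div_pow]
  rw [div_eq_inv_mul]
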